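/- Let G be a countable discrete infinite amenable group acting continuously on a compact metric space (X,d), let {F_n} be a tempered Følner sequence in G satisfying lim_{n→∞} |F_n|/log n = ∞, and let μ be a G-invariant Borel probability measure on X. If Y ⊆ X satisfies μ(Y) = 1, then h_μ(X,G) ≤ h^B_top(Y,{F_n}). -/

import Mathlib

open MeasureTheory Filter Set
open scoped Pointwise ENNReal NNReal Topology

section Defs

variable {G : Type*} [Group G] [DecidableEq G] {X : Type*}

/-- A Følner sequence: a sequence of nonempty finite subsets of `G` that is asymptotically
invariant: `|Fₙ △ gFₙ|/|Fₙ| → 0` for every `g ∈ G`. -/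
def IsFolnerSeq (F : ℕ → Finset G) : Prop :=
  (∀ n, (F n).Nonempty) ∧
    ∀ g : G, Tendsto (fun n => ((symmDiff (F n) ((F n).image (g * ·))).card : ℝ) / (F n).card)
      atTop (𝓝 0)

/-- A sequence of finite subsets is tempered if `|⋃_{k<n} Fₖ⁻¹ Fₙ| ≤ C |Fₙ|` for a constant `C`. -/
def IsTemperedSeq (F : ℕ → Finset G) : Prop :=
  ∃ C : ℝ, ∀ n : ℕ, (((Finset.range n).biUnion fun k => (F k)⁻¹ * F n).card : ℝ) ≤ C * (F n).card

/-- The growth condition `|Fₙ|/log n → ∞`. -/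
def GrowthCond (F : ℕ → Finset G) : Prop :=
  Tendsto (fun n => ((F n).card : ℝ) / Real.log n) atTop atTop

variable [MetricSpace X] [MulAction G X]

/-- The Bowen ball `B_F(x,ε) = {y : d(gx, gy) < ε for all g ∈ F}`. -/
def bowenBall (F : Finset G) (x : X) (ε : ℝ) : Set X :=
  {y | ∀ g ∈ F, dist (g • x) (g • y) < ε}

/-- `M(Z,N,ε,s,{Fₙ})`: infimum of `Σᵢ exp(-s |F_{nᵢ}|)` over countable families of Bowen balls
`B_{F_{nᵢ}}(xᵢ,ε)` with `nᵢ ≥ N` covering `Z`. -/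
noncomputable def bowenMpre (F : ℕ → Finset G) (Z : Set X) (N : ℕ) (ε s : ℝ) : ℝ≥0∞ :=
  ⨅ (C : Set (X × ℕ)) (_ : C.Countable ∧ (∀ p ∈ C, N ≤ p.2) ∧
      Z ⊆ ⋃ p ∈ C, bowenBall (F p.2) p.1 ε),
    ∑' p : C, ENNReal.ofReal (Real.exp (-s * ((F (p : X × ℕ).2).card : ℝ)))

/-- `M(Z,s,{Fₙ}) = lim_{ε→0} lim_{N→∞} M(Z,N,ε,s,{Fₙ})`; since the quantity is monotone
(nondecreasing as `N` increases and as `ε` decreases), the limits are suprema. -/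
noncomputable def bowenMeasure (F : ℕ → Finset G) (Z : Set X) (s : ℝ) : ℝ≥0∞ :=
  ⨆ (ε : ℝ) (_ : 0 < ε), ⨆ N : ℕ, bowenMpre F Z N ε s

/-- The Bowen topological entropy of `Z` along `{Fₙ}`: the critical value of `s` at which
`M(Z,s,{Fₙ})` jumps from `+∞` to `0`. -/
noncomputable def bowenEntropy (F : ℕ → Finset G) (Z : Set X) : ℝ≥0∞ :=
  ⨆ (s : ℝ) (_ : bowenMeasure F Z s = ⊤), ENNReal.ofReal s

/-- The minimal cardinality of a subcover of `⋁_{g ∈ F} g⁻¹ U` for a cover `U`. -/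
noncomputable def coverNumber (U : Finset (Set X)) (F : Finset G) : ℕ :=
  sInf {k : ℕ | ∃ f : Fin k → G → Set X, (∀ i, ∀ g ∈ F, f i g ∈ U) ∧
    (univ : Set X) ⊆ ⋃ i, ⋂ g ∈ F, (fun x => g • x) ⁻¹' f i g}

/-- The topological entropy of the `G`-action on `X` (computed along `{Fₙ}`; it is independent
of the Følner sequence). -/
noncomputable def topEntropy (X : Type*) [MetricSpace X] {G : Type*} [Group G] [MulAction G X]
    (F : ℕ → Finset G) : ℝ≥0∞ :=
  ⨆ (U : Finset (Set X)) (_ : (∀ V ∈ U, IsOpen V) ∧ ⋃₀ (U : Set (Set X)) = univ),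
    limsup (fun n => ENNReal.ofReal (Real.log (coverNumber U (F n)) / (F n).card)) atTop

end Defs

section MeasDefs

variable {G : Type*} [Group G] [DecidableEq G] {X : Type*} [MeasurableSpace X] [MulAction G X]

/-- The Shannon entropy `H_μ(⋁_{g∈F} g⁻¹ P)` of the join over `F` of the finite measurable
partition `P` given by the fibers of `α`. -/
noncomputable def partitionEntropy (μ : Measure X) {ι : Type*} [Fintype ι] (α : X → ι)
    (F : Finset G) : ℝ :=
  ∑ f : ↥F → ι, Real.negMulLog ((μ {x | ∀ g : ↥F, α ((g : G) • x) = f g}).toReal)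

/-- The entropy `h_μ(G,P) = lim_n H_μ(P^{Fₙ})/|Fₙ|` of the partition given by the fibers
of `α` (the limit existing, it is the `limsup`). -/
noncomputable def partitionDynEntropy (F : ℕ → Finset G) (μ : Measure X) {ι : Type*} [Fintype ι]
    (α : X → ι) : ℝ :=
  limsup (fun n => partitionEntropy μ α (F n) / (F n).card) atTop

/-- The measure-theoretic entropy `h_μ(X,G)`: the supremum over finite measurable partitions
(encoded as measurable maps `X → Fin k`) of `lim_n H_μ(P^{Fₙ})/|Fₙ|`. -/
noncomputable def measEntropy (F : ℕ → Finset G) (μ : Measure X) : ℝ≥0∞ :=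
  ⨆ (k : ℕ) (α : X → Fin k) (_ : Measurable α),
    limsup (fun n => ENNReal.ofReal (partitionEntropy μ α (F n) / (F n).card)) atTop

/-- `μ` is `G`-invariant. -/
def InvariantMeasure (G : Type*) [Group G] [MulAction G X] (μ : Measure X) : Prop :=
  ∀ g : G, Measure.map (fun x => g • x) μ = μ

/-- `μ` is ergodic: every Borel set `A` with `μ(A △ g⁻¹A) = 0` for all `g` is trivial. -/
def ErgodicMeasure (G : Type*) [Group G] [MulAction G X] (μ : Measure X) : Prop :=
  ∀ A : Set X, MeasurableSet A →
    (∀ g : G, μ (symmDiff A ((fun x => g • x) ⁻¹' A)) = 0) → μ A = 0 ∨ μ A = 1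

end MeasDefs

section LocalDefs

variable {G : Type*} [Group G] [DecidableEq G] {X : Type*} [MetricSpace X] [MulAction G X]
  [MeasurableSpace X]

/-- The set of generic points of `μ` with respect to `{Fₙ}`. -/
def genericPointSet (F : ℕ → Finset G) (μ : Measure X) : Set X :=
  {x | ∀ f : C(X, ℝ),
    Tendsto (fun n => (∑ g ∈ F n, f (g • x)) / (F n).card) atTop (𝓝 (∫ y, f y ∂μ))}

/-- The lower local entropy of `μ` at `x` along `{Fₙ}`:
`lim_{δ→0} liminf_n -(1/|Fₙ|) log μ(B_{Fₙ}(x,δ))` (the limit in `δ` being a supremum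
by monotonicity). -/
noncomputable def localLowerEntropy (F : ℕ → Finset G) (μ : Measure X) (x : X) : ℝ≥0∞ :=
  ⨆ (δ : ℝ) (_ : 0 < δ),
    liminf (fun n =>
      ENNReal.ofReal (-(Real.log ((μ (bowenBall (F n) x δ)).toReal)) / (F n).card)) atTop

end LocalDefs

section Helpers

/-- Gibbs-type bound on Shannon entropy. -/
lemma entropy_bound {Λ : Type*} [Fintype Λ] [DecidableEq Λ] (p : Λ → ℝ) (hp0 : ∀ f, 0 ≤ p f)
    (hsum : ∑ f, p f = 1) (S : Finset Λ) (A B δ : ℝ) (hA : 1 ≤ A) (hB : 1 ≤ B)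
    (hSA : (S.card : ℝ) ≤ A) (hSB : (Fintype.card Λ : ℝ) ≤ B) (hδ : ∑ f ∈ Sᶜ, p f ≤ δ) :
    ∑ f, Real.negMulLog (p f) ≤ Real.log 2 + Real.log A + δ * Real.log B := by
  have key : ∀ (a : ℝ), 0 ≤ a → ∀ (Q : ℝ), 1 ≤ Q →
      Real.negMulLog a ≤ a * (Real.log 2 + Real.log Q) + 1 / (2 * Q) - a := by
    intro a ha Q hQ
    have hQ0 : 0 < Q := by linarith
    rcases ha.eq_or_lt with h | h
    · subst h
      simp only [Real.negMulLog_zero, zero_mul, zero_add, sub_zero]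
      positivity
    · have h1 := Real.log_le_sub_one_of_pos (x := 1 / (2 * Q) / a) (by positivity)
      rw [Real.log_div (by positivity) h.ne', Real.log_div one_ne_zero (by positivity),
        Real.log_mul (by norm_num) hQ0.ne', Real.log_one] at h1
      have h2 := mul_le_mul_of_nonneg_left h1 ha
      have h3 : a * (1 / (2 * Q) / a - 1) = 1 / (2 * Q) - a := by field_simp
      rw [h3] at h2
      unfold Real.negMulLog
      linarith
  have part : ∀ (R : Finset Λ) (Q : ℝ), 1 ≤ Q → (R.card : ℝ) ≤ Q →
      ∑ f ∈ R, Real.negMulLog (p f) ≤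
        (∑ f ∈ R, p f) * (Real.log 2 + Real.log Q) + 1 / 2 - ∑ f ∈ R, p f := by
    intro R Q hQ hR
    have hQ0 : 0 < Q := by linarith
    calc ∑ f ∈ R, Real.negMulLog (p f)
        ≤ ∑ f ∈ R, (p f * (Real.log 2 + Real.log Q) + 1 / (2 * Q) - p f) :=
          Finset.sum_le_sum fun f _ => key _ (hp0 f) Q hQ
      _ = (∑ f ∈ R, p f) * (Real.log 2 + Real.log Q) + R.card * (1 / (2 * Q)) - ∑ f ∈ R, p f := by
          rw [Finset.sum_sub_distrib, Finset.sum_add_distrib, Finset.sum_mul]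
          simp
      _ ≤ _ := by
          have : (R.card : ℝ) * (1 / (2 * Q)) ≤ 1 / 2 := by
            rw [mul_one_div, div_le_iff₀ (by positivity)]; linarith
          linarith
  have h1 := part S A hA hSA
  have h2 := part Sᶜ B hB (le_trans (by exact_mod_cast Finset.card_le_univ _) hSB)
  have h3 : ∑ f ∈ S, p f + ∑ f ∈ Sᶜ, p f = 1 := by rw [Finset.sum_add_sum_compl, hsum]
  have h4 : ∑ f, Real.negMulLog (p f)
      = ∑ f ∈ S, Real.negMulLog (p f) + ∑ f ∈ Sᶜ, Real.negMulLog (p f) := by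
    rw [Finset.sum_add_sum_compl]
  have hS0 : 0 ≤ ∑ f ∈ Sᶜ, p f := Finset.sum_nonneg fun f _ => hp0 f
  have hlA := Real.log_nonneg hA
  have hlB := Real.log_nonneg hB
  have h5 := mul_le_mul_of_nonneg_right hδ hlB
  have h6 : (∑ f ∈ S, p f) * Real.log A ≤ 1 * Real.log A :=
    mul_le_mul_of_nonneg_right (by linarith) hlA
  have h7 : (∑ f ∈ S, p f) * Real.log 2 + (∑ f ∈ Sᶜ, p f) * Real.log 2 = Real.log 2 := by
    rw [← add_mul, h3, one_mul]
  rw [h4]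
  linarith

/-- Single level greedy almost disjoint family. -/
lemma greedy_level {G : Type*} [Group G] [DecidableEq G] (F A : Finset G) (ε : ℝ)
    (hε1 : ε ≤ 1 / 2) (hF : F.Nonempty) :
    ∃ Q ⊆ A, (1 - ε) * (Q.card * F.card : ℝ) ≤ ((F * Q).card : ℝ) ∧
      ε * A.card ≤ ((F * Q).card : ℝ) := by
  classical
  set P := A.powerset.filter
    (fun Q => (1 - ε) * (Q.card * F.card : ℝ) ≤ ((F * Q).card : ℝ)) with hP
  have hPne : P.Nonempty := ⟨∅, by simp [hP]⟩
  obtain ⟨Q, hQP, hmax⟩ := Finset.exists_max_image P Finset.card hPne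
  have hQ := hQP
  rw [hP, Finset.mem_filter, Finset.mem_powerset] at hQ
  refine ⟨Q, hQ.1, hQ.2, ?_⟩
  have hFpos : (0 : ℝ) < F.card := by exact_mod_cast hF.card_pos
  have hcard : ∀ c, (F * {c}).card = F.card := fun c => by simp
  have each : ∀ c ∈ A, ε * F.card ≤ (((F * {c}) ∩ (F * Q)).card : ℝ) := by
    intro c hc
    by_cases hcQ : c ∈ Q
    · rw [Finset.inter_eq_left.mpr (Finset.mul_subset_mul_left (by simpa using hcQ)), hcard]
      nlinarith
    · by_contra hlt
      push Not at hlt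
      have hun : F * insert c Q = (F * {c}) ∪ (F * Q) := by
        rw [Finset.insert_eq, Finset.mul_union]
      have hc1 : (((F * {c}) ∪ (F * Q)).card : ℝ) + (((F * {c}) ∩ (F * Q)).card : ℝ)
          = F.card + (F * Q).card := by
        rw [← hcard c]; exact_mod_cast Finset.card_union_add_card_inter _ _
      have hmem : insert c Q ∈ P := by
        rw [hP, Finset.mem_filter, Finset.mem_powerset]
        refine ⟨Finset.insert_subset hc hQ.1, ?_⟩
        rw [hun, Finset.card_insert_of_notMem hcQ]
        push_cast
        nlinarith [hQ.2]
      have := hmax _ hmem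
      rw [Finset.card_insert_of_notMem hcQ] at this
      omega
  have dc : ∑ c ∈ A, ((F * {c}) ∩ (F * Q)).card ≤ (F * Q).card * F.card := by
    calc ∑ c ∈ A, ((F * {c}) ∩ (F * Q)).card
        = ∑ c ∈ A, ∑ u ∈ F * Q, if u ∈ F * {c} then 1 else 0 := by
          refine Finset.sum_congr rfl fun c _ => ?_
          rw [Finset.inter_comm, ← Finset.filter_mem_eq_inter, Finset.card_filter]
      _ = ∑ u ∈ F * Q, ∑ c ∈ A, if u ∈ F * {c} then 1 else 0 := Finset.sum_comm
      _ ≤ ∑ u ∈ F * Q, F.card := by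
          refine Finset.sum_le_sum fun u _ => ?_
          rw [← Finset.card_filter]
          refine (Finset.card_le_card (t := F⁻¹ * {u}) ?_).trans (by simp)
          intro c hc
          rw [Finset.mem_filter] at hc
          obtain ⟨f, hf, c', hc', h⟩ := Finset.mem_mul.mp hc.2
          rw [Finset.mem_singleton] at hc'
          subst hc'
          exact Finset.mem_mul.mpr ⟨f⁻¹, Finset.inv_mem_inv hf, u, by simp, by rw [← h]; group⟩
      _ = _ := by simp
  have h1 : (A.card : ℝ) * (ε * F.card) ≤ (F * Q).card * F.card := by
    calc (A.card : ℝ) * (ε * F.card) = ∑ c ∈ A, ε * F.card := by simp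
      _ ≤ ∑ c ∈ A, (((F * {c}) ∩ (F * Q)).card : ℝ) := Finset.sum_le_sum each
      _ ≤ _ := by exact_mod_cast dc
  have h2 : (ε * A.card) * F.card ≤ (F * Q).card * F.card := by linarith
  exact le_of_mul_le_mul_right h2 hFpos

/-- Covering lemma for a tempered sequence: one block. -/
lemma cover_block {G : Type*} [Group G] [DecidableEq G] (F : ℕ → Finset G)
    (hne : ∀ n, (F n).Nonempty) (C : ℝ) (hC0 : 0 ≤ C)
    (hC : ∀ n : ℕ, (((Finset.range n).biUnion fun k => (F k)⁻¹ * F n).card : ℝ) ≤ C * (F n).card)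
    (ν : G → ℕ) (ε : ℝ) (hε : 0 < ε) (hε1 : ε ≤ 1 / 2) :
    ∀ (a : ℕ) (A : Finset G), A.card ≤ a → ∃ Q ⊆ A,
      (1 - ε) * (∑ c ∈ Q, ((F (ν c)).card : ℝ)) ≤ ((Q.biUnion fun c => F (ν c) * {c}).card : ℝ) ∧
      (A.card : ℝ) ≤ (1 / ε + 2 * C) * ((Q.biUnion fun c => F (ν c) * {c}).card : ℝ) := by
  classical
  intro a
  induction a with
  | zero =>
    intro A hA
    have : A = ∅ := by simpa using hA
    exact ⟨∅, by simp, by simp, by simp [this]⟩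
  | succ a ih =>
    intro A hA
    rcases A.eq_empty_or_nonempty with rfl | hAne
    · exact ⟨∅, by simp, by simp, by simp⟩
    obtain ⟨c0, hc0, hmax⟩ := Finset.exists_max_image A ν hAne
    set k := ν c0 with hk
    obtain ⟨Q1, hQ1, hd1, hs1⟩ := greedy_level (F k) (A.filter (fun c => ν c = k)) ε hε1 (hne k)
    set U1 := F k * Q1 with hU1
    set A' := A.filter (fun c => ν c ≠ k ∧ Disjoint (F (ν c) * {c}) U1) with hA'
    have hA'lt : A'.card ≤ a := by
      have : A'.card < A.card := by
        refine Finset.card_lt_card (Finset.filter_ssubset.mpr ⟨c0, hc0, by simp [hk]⟩)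
      omega
    obtain ⟨Q2, hQ2, hd2, hs2⟩ := ih A' hA'lt
    set U2 := Q2.biUnion fun c => F (ν c) * {c} with hU2
    have hQ1k : ∀ c ∈ Q1, ν c = k := fun c hc => (Finset.mem_filter.mp (hQ1 hc)).2
    have hQdisj : Disjoint Q1 Q2 := by
      rw [Finset.disjoint_left]
      intro c h1 h2
      exact (Finset.mem_filter.mp (hQ2 h2)).2.1 (hQ1k c h1)
    have hU1' : (Q1.biUnion fun c => F (ν c) * {c}) = U1 := by
      rw [hU1]
      ext u
      simp only [Finset.mem_biUnion, Finset.mem_mul, Finset.mem_singleton]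
      constructor
      · rintro ⟨c, hc, f, hf, c', hc', rfl⟩
        exact ⟨f, hQ1k c hc ▸ hf, c, hc, by rw [hc']⟩
      · rintro ⟨f, hf, c, hc, rfl⟩
        exact ⟨c, hc, f, (hQ1k c hc).symm ▸ hf, c, rfl, rfl⟩
    have hUdisj : Disjoint U1 U2 := by
      rw [hU2, Finset.disjoint_biUnion_right]
      intro c hc
      exact (Finset.mem_filter.mp (hQ2 hc)).2.2.symm
    have hcov : ((Q1 ∪ Q2).biUnion fun c => F (ν c) * {c}) = U1 ∪ U2 := by
      rw [Finset.union_biUnion, hU1']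
    have hcard : (((Q1 ∪ Q2).biUnion fun c => F (ν c) * {c}).card : ℝ) = U1.card + U2.card := by
      rw [hcov, Finset.card_union_of_disjoint hUdisj]; push_cast; rfl
    have hsum1 : ∑ c ∈ Q1, ((F (ν c)).card : ℝ) = Q1.card * (F k).card := by
      rw [Finset.sum_congr rfl (fun c hc => by rw [hQ1k c hc])]; simp
    refine ⟨Q1 ∪ Q2, Finset.union_subset (hQ1.trans (Finset.filter_subset _ _))
      (hQ2.trans (Finset.filter_subset _ _)), ?_, ?_⟩
    · rw [hcard, Finset.sum_union hQdisj, hsum1, mul_add]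
      linarith
    · rw [hcard]
      set Bl := (((Finset.range k).biUnion fun j => (F j)⁻¹ * F k) * Q1) with hBl
      have hsub : A ⊆ (A.filter (fun c => ν c = k)) ∪ (Bl ∪ A') := by
        intro c hc
        by_cases h1 : ν c = k
        · exact Finset.mem_union_left _ (Finset.mem_filter.mpr ⟨hc, h1⟩)
        refine Finset.mem_union_right _ ?_
        by_cases h2 : Disjoint (F (ν c) * {c}) U1
        · exact Finset.mem_union_right _ (Finset.mem_filter.mpr ⟨hc, h1, h2⟩)
        refine Finset.mem_union_left _ ?_
        rw [Finset.not_disjoint_iff] at h2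
        obtain ⟨u, hu1, hu2⟩ := h2
        obtain ⟨f, hf, c', hc', rfl⟩ := Finset.mem_mul.mp hu1
        rw [Finset.mem_singleton] at hc'
        subst hc'
        obtain ⟨f', hf', q, hq, h⟩ := Finset.mem_mul.mp hu2
        refine Finset.mem_mul.mpr ⟨f⁻¹ * f', ?_, q, hq, ?_⟩
        · refine Finset.mem_biUnion.mpr ⟨ν c', ?_, Finset.mul_mem_mul (Finset.inv_mem_inv hf) hf'⟩
          rw [Finset.mem_range]
          exact lt_of_le_of_ne (hmax c' hc) h1
        · rw [mul_assoc, h]; group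
      have hBlc : (Bl.card : ℝ) ≤ 2 * C * U1.card := by
        have h1 : (Bl.card : ℝ) ≤ C * (F k).card * Q1.card := by
          calc (Bl.card : ℝ) ≤ (((Finset.range k).biUnion fun j => (F j)⁻¹ * F k).card : ℝ)
                * Q1.card := by exact_mod_cast Finset.card_mul_le
            _ ≤ _ := mul_le_mul_of_nonneg_right (hC k) (by positivity)
        have h2 : (1 / 2 : ℝ) * (Q1.card * (F k).card) ≤ U1.card := by
          refine le_trans (mul_le_mul_of_nonneg_right (by linarith) (by positivity)) hd1
        nlinarith
      have hA1 : ((A.filter (fun c => ν c = k)).card : ℝ) ≤ 1 / ε * U1.card := by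
        rw [one_div, inv_mul_eq_div, le_div_iff₀ hε]; linarith
      have hle : (A.card : ℝ) ≤ (A.filter (fun c => ν c = k)).card + (Bl.card + A'.card) := by
        have h1 := Finset.card_le_card hsub
        have h2 := Finset.card_union_le (A.filter (fun c => ν c = k)) (Bl ∪ A')
        have h3 := Finset.card_union_le Bl A'
        exact_mod_cast (by omega)
      nlinarith

/-- The `E`-boundary of `D`. -/
def bdry {G : Type*} [Group G] [DecidableEq G] (E D : Finset G) : Finset G :=
  E.biUnion fun g => symmDiff D (D.image (g⁻¹ * ·))

lemma not_mem_bdry {G : Type*} [Group G] [DecidableEq G] {E D : Finset G} {c : G}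
    (hc : c ∉ bdry E D) {g : G} (hg : g ∈ E) : c ∈ D ↔ g * c ∈ D := by
  simp only [bdry, Finset.mem_biUnion, not_exists, not_and] at hc
  have := hc g hg
  rw [Finset.mem_symmDiff] at this
  have h : c ∈ D.image (g⁻¹ * ·) ↔ g * c ∈ D := by
    simp only [Finset.mem_image]
    constructor
    · rintro ⟨a, ha, rfl⟩; simpa using ha
    · intro h; exact ⟨_, h, by simp⟩
  rw [h] at this
  tauto

lemma bdry_small {G : Type*} [Group G] [DecidableEq G] {F : ℕ → Finset G} (hF : IsFolnerSeq F)
    (E : Finset G) (θ : ℝ) (hθ : 0 < θ) :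
    ∀ᶠ n in atTop, ((bdry E (F n)).card : ℝ) ≤ θ * (F n).card := by
  have h1 : Tendsto (fun n => ∑ g ∈ E,
      ((symmDiff (F n) ((F n).image (g⁻¹ * ·))).card : ℝ) / (F n).card) atTop (𝓝 0) := by
    have := tendsto_finsetSum E (fun g _ => hF.2 g⁻¹)
    simpa using this
  filter_upwards [h1.eventually (gt_mem_nhds hθ)] with n hn
  have hpos : (0 : ℝ) < (F n).card := by exact_mod_cast (hF.1 n).card_pos
  rw [← Finset.sum_div, div_lt_iff₀ hpos] at hn
  refine le_trans ?_ hn.le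
  exact_mod_cast Finset.card_biUnion_le

lemma isOpen_bowenBall {G : Type*} [Group G] {X : Type*} [MetricSpace X] [MulAction G X]
    [ContinuousConstSMul G X] (F : Finset G) (x : X) (ε : ℝ) : IsOpen (bowenBall F x ε) := by
  have : bowenBall F x ε = ⋂ g ∈ F, {y | dist (g • x) (g • y) < ε} := by
    ext y; simp [bowenBall]
  rw [this]
  refine isOpen_biInter_finset fun g _ => ?_
  exact isOpen_lt (continuous_const.dist (continuous_const_smul g)) continuous_const

lemma growth_card {G : Type*} [Group G] {F : ℕ → Finset G} (h : GrowthCond F) :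
    Tendsto (fun n => ((F n).card : ℝ)) atTop atTop := by
  have hlog : Tendsto (fun n : ℕ => Real.log n) atTop atTop :=
    Real.tendsto_log_atTop.comp tendsto_natCast_atTop_atTop
  refine (h.atTop_mul_atTop₀ hlog).congr' ?_
  filter_upwards [hlog.eventually_gt_atTop 0] with n hn
  exact div_mul_cancel₀ _ hn.ne'

/-- From finiteness of the Bowen measure at `s₀ < s` get cheap finite blocks covering most of `X`. -/
lemma exists_block {G : Type*} [Group G] {X : Type*} [MetricSpace X]
    [CompactSpace X] [MulAction G X] [ContinuousConstSMul G X] [MeasurableSpace X] [BorelSpace X]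
    (F : ℕ → Finset G) (hGrow : GrowthCond F) (μ : Measure X) [IsProbabilityMeasure μ]
    (Y : Set X) (hY : μ Y = 1) (s₀ s : ℝ) (hs : s₀ < s) (hfin : bowenMeasure F Y s₀ ≠ ⊤)
    (r : ℝ) (hr : 0 < r) (N₀ : ℕ) (τ : ℝ) (hτ : 0 < τ) (δ : ℝ) (hδ : 0 < δ) :
    ∃ I : Finset (X × ℕ), (∀ p ∈ I, N₀ ≤ p.2) ∧
      ∑ p ∈ I, Real.exp (-s * ((F p.2).card : ℝ)) ≤ τ ∧
      μ (⋃ p ∈ I, bowenBall (F p.2) p.1 r)ᶜ ≤ ENNReal.ofReal δ := by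
  classical
  set M := (bowenMeasure F Y s₀).toReal + 1 with hM
  have hMpos : 0 < M := by positivity
  have hcard := growth_card hGrow
  have hexp : Tendsto (fun n => M * Real.exp (-((s - s₀) * ((F n).card : ℝ)))) atTop (𝓝 0) := by
    have h1 : Tendsto (fun n => (s - s₀) * ((F n).card : ℝ)) atTop atTop :=
      hcard.const_mul_atTop (by linarith)
    simpa using (Real.tendsto_exp_neg_atTop_nhds_zero.comp h1).const_mul M
  obtain ⟨N₁, hN₁⟩ := eventually_atTop.mp (hexp.eventually (gt_mem_nhds hτ))
  set N := max N₀ N₁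
  have hlt : bowenMpre F Y N r s₀ < ENNReal.ofReal M := by
    have h1 : bowenMpre F Y N r s₀ ≤ bowenMeasure F Y s₀ :=
      le_trans (le_iSup (fun N => bowenMpre F Y N r s₀) N)
        (le_iSup₂ (f := fun (ε : ℝ) (_ : 0 < ε) => ⨆ N : ℕ, bowenMpre F Y N ε s₀) r hr)
    refine h1.trans_lt ?_
    rw [← ENNReal.ofReal_toReal hfin]
    exact (ENNReal.ofReal_lt_ofReal_iff hMpos).mpr (by rw [hM]; linarith)
  rw [bowenMpre, iInf_lt_iff] at hlt
  obtain ⟨C, hC⟩ := hlt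
  rw [iInf_lt_iff] at hC
  obtain ⟨⟨-, hCN, hCY⟩, hsum⟩ := hC
  set O := ⋃ p ∈ C, bowenBall (F p.2) p.1 r with hO
  have hOopen : IsOpen O := isOpen_biUnion fun p _ => isOpen_bowenBall _ _ _
  have hμO : μ O = 1 := le_antisymm prob_le_one (hY ▸ measure_mono hCY)
  obtain ⟨K, hKO, hK, hKμ⟩ := hOopen.measurableSet.exists_isCompact_lt_add (μ := μ)
    (by rw [hμO]; exact ENNReal.one_ne_top) (ε := ENNReal.ofReal δ) (by simpa using hδ)
  obtain ⟨b, hbC, hbfin, hbK⟩ := hK.elim_finite_subcover_image (b := C)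
    (c := fun p => bowenBall (F p.2) p.1 r) (fun p _ => isOpen_bowenBall _ _ _) hKO
  refine ⟨hbfin.toFinset, ?_, ?_, ?_⟩
  · intro p hp
    exact (le_max_left _ _).trans (hCN p (hbC (hbfin.mem_toFinset.mp hp)))
  · have h1 : ∑ p ∈ hbfin.toFinset, ENNReal.ofReal (Real.exp (-s₀ * ((F p.2).card : ℝ)))
        ≤ ENNReal.ofReal M := by
      refine le_trans ?_ hsum.le
      have h2 := ENNReal.sum_le_tsum (f := fun p : C =>
        ENNReal.ofReal (Real.exp (-s₀ * ((F (p : X × ℕ).2).card : ℝ))))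
        (hbfin.toFinset.subtype (· ∈ C))
      refine le_trans (le_of_eq ?_) h2
      rw [Finset.sum_subtype_eq_sum_filter (s := hbfin.toFinset) (p := (· ∈ C))
        (f := fun p => ENNReal.ofReal (Real.exp (-s₀ * ((F (p : X × ℕ).2).card : ℝ))))]
      rw [Finset.filter_true_of_mem]
      intro p hp
      exact hbC (hbfin.mem_toFinset.mp hp)
    rw [← ENNReal.ofReal_sum_of_nonneg (fun p _ => (Real.exp_pos _).le),
      ENNReal.ofReal_le_ofReal_iff hMpos.le] at h1
    have h3 : ∀ p ∈ hbfin.toFinset, Real.exp (-s * ((F p.2).card : ℝ)) ≤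
        τ / M * Real.exp (-s₀ * ((F p.2).card : ℝ)) := by
      intro p hp
      have hp2 : N₁ ≤ p.2 := (le_max_right _ _).trans (hCN p (hbC (hbfin.mem_toFinset.mp hp)))
      have h4 : Real.exp (-((s - s₀) * ((F p.2).card : ℝ))) ≤ τ / M := by
        rw [le_div_iff₀ hMpos, mul_comm]; exact (hN₁ _ hp2).le
      have h5 : Real.exp (-s * ((F p.2).card : ℝ)) =
          Real.exp (-((s - s₀) * ((F p.2).card : ℝ))) * Real.exp (-s₀ * ((F p.2).card : ℝ)) := by
        rw [← Real.exp_add]; ring_nf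
      rw [h5]
      exact mul_le_mul_of_nonneg_right h4 (Real.exp_pos _).le
    calc _ ≤ ∑ p ∈ hbfin.toFinset, τ / M * Real.exp (-s₀ * ((F p.2).card : ℝ)) :=
          Finset.sum_le_sum h3
      _ = τ / M * ∑ p ∈ hbfin.toFinset, Real.exp (-s₀ * ((F p.2).card : ℝ)) := by
          rw [Finset.mul_sum]
      _ ≤ τ / M * M := mul_le_mul_of_nonneg_left h1 (by positivity)
      _ = τ := by field_simp
  · have hsub : (⋃ p ∈ hbfin.toFinset, bowenBall (F p.2) p.1 r)ᶜ ⊆ Kᶜ := by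
      refine compl_subset_compl.mpr (hbK.trans ?_)
      intro y hy
      simpa using hy
    refine (measure_mono hsub).trans ?_
    rw [prob_compl_eq_one_sub hK.measurableSet]
    rw [hμO] at hKμ
    exact tsub_le_iff_left.mpr hKμ.le

/-- Lusin-type approximation of a finite partition. -/
lemma exists_lusin {X : Type*} [MetricSpace X] [CompactSpace X] [MeasurableSpace X] [BorelSpace X]
    (μ : Measure X) [IsProbabilityMeasure μ] {k : ℕ} (α : X → Fin k) (hα : Measurable α)
    (δ : ℝ) (hδ : 0 < δ) :
    ∃ (K : Set X) (r : ℝ) (lam : X → Fin k), MeasurableSet K ∧ 0 < r ∧ μ Kᶜ ≤ ENNReal.ofReal δ ∧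
      ∀ y ∈ K, ∀ z, dist z y < r → lam z = α y := by
  classical
  have hX : Nonempty X := by
    by_contra h
    rw [not_nonempty_iff] at h
    have h1 := measure_univ (μ := μ)
    rw [univ_eq_empty_iff.mpr h, measure_empty] at h1
    exact zero_ne_one h1
  obtain ⟨x₀⟩ := hX
  have hk : 0 < k := Fin.pos (α x₀)
  have hms : ∀ j, MeasurableSet (α ⁻¹' {j}) := fun j => hα (measurableSet_singleton j)
  have hk' : (0 : ℝ) < k := by exact_mod_cast hk
  have hex : ∀ j, ∃ K ⊆ α ⁻¹' {j}, IsCompact K ∧ μ (α ⁻¹' {j} \ K) < ENNReal.ofReal (δ / k) := by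
    intro j
    exact (hms j).exists_isCompact_sdiff_lt (measure_ne_top _ _) (by simp; positivity)
  choose K hKs hKc hKμ using hex
  have hdisj : ∀ i j, i ≠ j → ∃ r, 0 < r ∧
      Disjoint (Metric.thickening r (K i)) (Metric.thickening r (K j)) := by
    intro i j hij
    refine Disjoint.exists_thickenings ?_ (hKc i) (hKc j).isClosed
    rw [Set.disjoint_left]
    intro y hi hj
    exact hij ((hKs i hi).symm.trans (hKs j hj))
  obtain ⟨r, hr, hrd⟩ : ∃ r, 0 < r ∧ ∀ i j, i ≠ j →
      Disjoint (Metric.thickening r (K i)) (Metric.thickening r (K j)) := by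
    have h1 : ∀ᶠ r in 𝓝[>] (0 : ℝ), ∀ i j, i ≠ j →
        Disjoint (Metric.thickening r (K i)) (Metric.thickening r (K j)) := by
      rw [eventually_all]; intro i
      rw [eventually_all]; intro j
      by_cases hij : i = j
      · simp [hij]
      obtain ⟨r, hr, hd⟩ := hdisj i j hij
      filter_upwards [Ioo_mem_nhdsGT hr] with r' hr' _
      exact hd.mono (Metric.thickening_mono hr'.2.le _) (Metric.thickening_mono hr'.2.le _)
    obtain ⟨r, h2, h3⟩ := (h1.and self_mem_nhdsWithin).exists
    exact ⟨r, h3, h2⟩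
  refine ⟨⋃ j, K j, r,
    fun z => if h : ∃ j, z ∈ Metric.thickening r (K j) then h.choose else α x₀,
    MeasurableSet.iUnion fun j => (hKc j).measurableSet, hr, ?_, ?_⟩
  · have hsub : (⋃ j, K j)ᶜ ⊆ ⋃ j, (α ⁻¹' {j} \ K j) := by
      intro y hy
      rw [mem_iUnion]
      refine ⟨α y, rfl, fun h => hy (mem_iUnion.mpr ⟨_, h⟩)⟩
    calc μ (⋃ j, K j)ᶜ ≤ μ (⋃ j, (α ⁻¹' {j} \ K j)) := measure_mono hsub
      _ ≤ ∑ j, μ (α ⁻¹' {j} \ K j) := measure_iUnion_fintype_le _ _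
      _ ≤ ∑ _j : Fin k, ENNReal.ofReal (δ / k) := Finset.sum_le_sum fun j _ => (hKμ j).le
      _ = ENNReal.ofReal δ := by
        rw [← ENNReal.ofReal_sum_of_nonneg (fun _ _ => by positivity)]
        congr 1
        simp
        field_simp
  · intro y hy z hzy
    obtain ⟨j, hj⟩ := mem_iUnion.mp hy
    have hz : z ∈ Metric.thickening r (K j) := Metric.mem_thickening_iff.mpr ⟨y, hj, hzy⟩
    have hαy : α y = j := hKs j hj
    have h : ∃ j, z ∈ Metric.thickening r (K j) := ⟨j, hz⟩
    simp only [dif_pos h]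
    rw [hαy]
    by_contra hne
    exact Set.disjoint_left.mp (hrd _ _ hne) h.choose_spec hz

/-- Markov inequality for the number of visits. -/
lemma bad_measure {G : Type*} [Group G] {X : Type*} [MetricSpace X] [MulAction G X]
    [ContinuousConstSMul G X] [MeasurableSpace X] [BorelSpace X]
    (μ : Measure X) [IsProbabilityMeasure μ] (hinv : InvariantMeasure G μ) (D : Finset G)
    (hD : D.Nonempty) (V : Set X) [∀ x, DecidablePred fun c : G => c • x ∉ V]
    (hV : MeasurableSet V) (δ ε : ℝ) (hδ : 0 ≤ δ) (hε : 0 < ε)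
    (hμ : μ Vᶜ ≤ ENNReal.ofReal δ) :
    μ.real {x | ε * D.card < ((D.filter fun c => c • x ∉ V).card : ℝ)} ≤ δ / ε := by
  classical
  have hDpos : (0 : ℝ) < D.card := by exact_mod_cast hD.card_pos
  set f : X → ℝ≥0∞ := fun x => ∑ c ∈ D, Vᶜ.indicator 1 (c • x) with hf
  have hmeas : ∀ c : G, Measurable fun x : X => c • x := fun c => (continuous_const_smul c).measurable
  have hind : Measurable (Vᶜ.indicator (1 : X → ℝ≥0∞)) := measurable_one.indicator hV.compl
  have hfm : Measurable f := Finset.measurable_sum _ fun c _ => hind.comp (hmeas c)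
  have hintegral : ∫⁻ x, f x ∂μ = D.card * μ Vᶜ := by
    have h0 := lintegral_finsetSum (μ := μ) D (f := fun c x => Vᶜ.indicator (1 : X → ℝ≥0∞) (c • x))
      (fun c _ => hind.comp (hmeas c))
    refine h0.trans ?_
    rw [Finset.sum_congr rfl (g := fun _ => μ Vᶜ)]
    · simp
    · intro c _
      rw [← lintegral_map hind (hmeas c), hinv c, lintegral_indicator_one hV.compl]
  have hfx : ∀ x, f x = ((D.filter fun c => c • x ∉ V).card : ℝ≥0∞) := by
    intro x
    rw [hf, Finset.card_filter]
    push_cast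
    refine Finset.sum_congr rfl fun c _ => ?_
    by_cases h : c • x ∈ V <;> simp [h]
  have h1 := mul_meas_ge_le_lintegral (μ := μ) hfm (ENNReal.ofReal (ε * D.card))
  have h2 : {x | ε * D.card < ((D.filter fun c => c • x ∉ V).card : ℝ)} ⊆
      {x | ENNReal.ofReal (ε * D.card) ≤ f x} := by
    intro x hx
    simp only [mem_ofPred_eq] at hx ⊢
    rw [hfx, ← ENNReal.ofReal_natCast]
    exact ENNReal.ofReal_le_ofReal hx.le
  have h3 : ENNReal.ofReal (ε * D.card) *
      μ {x | ε * D.card < ((D.filter fun c => c • x ∉ V).card : ℝ)} ≤ ENNReal.ofReal (D.card * δ) := by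
    calc _ ≤ _ := mul_le_mul_right (measure_mono h2) _
      _ ≤ _ := h1
      _ = D.card * μ Vᶜ := hintegral
      _ ≤ D.card * ENNReal.ofReal δ := mul_le_mul_right hμ _
      _ = _ := by rw [ENNReal.ofReal_mul hDpos.le, ENNReal.ofReal_natCast]
  have h4 := ENNReal.toReal_mono ENNReal.ofReal_ne_top h3
  rw [ENNReal.toReal_mul, ENNReal.toReal_ofReal (by positivity),
    ENNReal.toReal_ofReal (by positivity)] at h4
  rw [le_div_iff₀ hε]
  have h5 : D.card * (μ.real {x | ε * D.card < ((D.filter fun c => c • x ∉ V).card : ℝ)} * ε)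
      ≤ D.card * δ := by
    unfold Measure.real; linarith
  exact le_of_mul_le_mul_left h5 hDpos

/-- The tile attached to a labelled centre. -/
def tile {G : Type*} [Group G] [DecidableEq G] {X : Type*} (F : ℕ → Finset G)
    (t : G × X × ℕ) : Finset G := F t.2.2 * {t.1}

/-- The multi-scale covering statement. -/
lemma multi_cover {G : Type*} [Group G] [DecidableEq G] {X : Type*} [MetricSpace X]
    [MulAction G X] [ContinuousConstSMul G X] [MeasurableSpace X] [BorelSpace X]
    (F : ℕ → Finset G) (hFol : IsFolnerSeq F) (C : ℝ) (hC0 : 0 ≤ C)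
    (hC : ∀ n : ℕ, (((Finset.range n).biUnion fun k => (F k)⁻¹ * F n).card : ℝ) ≤ C * (F n).card)
    (μ : Measure X) (s r : ℝ)
    (hblock : ∀ (N₀ : ℕ) (τ : ℝ), 0 < τ → ∀ δ : ℝ, 0 < δ →
      ∃ I : Finset (X × ℕ), (∀ p ∈ I, N₀ ≤ p.2) ∧
      ∑ p ∈ I, Real.exp (-s * ((F p.2).card : ℝ)) ≤ τ ∧
      μ (⋃ p ∈ I, bowenBall (F p.2) p.1 r)ᶜ ≤ ENNReal.ofReal δ)
    (ε : ℝ) (hε : 0 < ε) (hε1 : ε ≤ 1 / 2) (ε' θ : ℝ) (hε' : 0 < ε') (hθ : 0 < θ)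
    (γ : ℝ) (hγ : γ = (1 / ε + 2 * C)⁻¹) (J : ℕ) :
    ∀ (τ : ℝ), 0 < τ → ∀ δ : ℝ, 0 < δ → ∀ N₀ : ℕ,
      ∃ (I : Finset (X × ℕ)) (V : Set X), (∀ p ∈ I, N₀ ≤ p.2) ∧
        ∑ p ∈ I, Real.exp (-s * ((F p.2).card : ℝ)) ≤ τ ∧ MeasurableSet V ∧
        μ Vᶜ ≤ ENNReal.ofReal δ ∧
        ∀ᶠ m in atTop, ∀ x : X, ∀ B : Finset G, (∀ c ∈ F m, c • x ∉ V → c ∈ B) →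
          (B.card : ℝ) ≤ ε' * (F m).card →
          ∃ T : Finset (G × X × ℕ), (∀ t ∈ T, t.1 ∈ F m ∧ t.2 ∈ I ∧
              t.1 • x ∈ bowenBall (F t.2.2) t.2.1 r ∧ tile F t ⊆ F m) ∧
            (1 - ε) * ∑ t ∈ T, ((F t.2.2).card : ℝ) ≤ ((T.biUnion (tile F)).card : ℝ) ∧
            ((F m \ T.biUnion (tile F)).card : ℝ) ≤ ((1 - γ) ^ J + ε' + 3 * θ) * (F m).card := by
  classical
  have hKpos : 2 ≤ 1 / ε + 2 * C := by
    have : 2 ≤ 1 / ε := by rw [le_div_iff₀ hε]; linarith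
    linarith
  have hγ0 : 0 < γ := by rw [hγ]; positivity
  have hγ1 : γ ≤ 1 := by
    rw [hγ]; exact inv_le_one_of_one_le₀ (by linarith)
  induction J with
  | zero =>
    intro τ hτ δ hδ N₀
    refine ⟨∅, univ, by simp, by simpa using hτ.le, MeasurableSet.univ, by simp, ?_⟩
    refine Eventually.of_forall fun m x B _ _ => ⟨∅, by simp, by simp, ?_⟩
    simp only [Finset.biUnion_empty, Finset.sdiff_empty, pow_zero]
    have : (0 : ℝ) ≤ (F m).card := by positivity
    nlinarith
  | succ J ih =>
    intro τ hτ δ hδ N₀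
    obtain ⟨I₀, hI₀N, hI₀τ, hI₀μ⟩ := hblock N₀ (τ / 2) (by positivity) (δ / 2) (by positivity)
    set E : Finset G := I₀.biUnion fun p => F p.2 with hE
    obtain ⟨N₁, hN₁⟩ := eventually_atTop.mp (bdry_small hFol E θ hθ)
    obtain ⟨I₁, V₁, hI₁N, hI₁τ, hV₁, hV₁μ, hev⟩ :=
      ih (τ / 2) (by positivity) (δ / 2) (by positivity) (max N₀ N₁)
    set V₀ : Set X := ⋃ p ∈ I₀, bowenBall (F p.2) p.1 r with hV₀
    refine ⟨I₀ ∪ I₁, V₀ ∩ V₁, ?_, ?_, ?_, ?_, ?_⟩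
    · intro p hp
      rcases Finset.mem_union.mp hp with h | h
      · exact hI₀N p h
      · exact (le_max_left _ _).trans (hI₁N p h)
    · have h1 : ∑ p ∈ I₀ ∪ I₁, Real.exp (-s * ((F p.2).card : ℝ)) ≤
          ∑ p ∈ I₀, Real.exp (-s * ((F p.2).card : ℝ)) +
          ∑ p ∈ I₁, Real.exp (-s * ((F p.2).card : ℝ)) := by
        rw [← Finset.sum_union_inter]
        exact le_add_of_nonneg_right (Finset.sum_nonneg fun _ _ => (Real.exp_pos _).le)
      linarith
    · exact ((isOpen_biUnion fun p _ => isOpen_bowenBall _ _ _).measurableSet).inter hV₁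
    · rw [compl_inter]
      refine (measure_union_le _ _).trans ((add_le_add hI₀μ hV₁μ).trans ?_)
      rw [← ENNReal.ofReal_add (by positivity) (by positivity)]
      simp
    filter_upwards [hev, bdry_small hFol E θ hθ] with m hm hmb x B hB hBc
    obtain ⟨T, hT, hTd, hTc⟩ := hm x B (fun c hc h => hB c hc fun h' => h h'.2) hBc
    set D := F m with hD
    set U := T.biUnion (tile F) with hU
    have hUD : U ⊆ D := Finset.biUnion_subset.mpr fun t ht => (hT t ht).2.2.2
    set BT := T.biUnion fun t => bdry E (F t.2.2) * {t.1} with hBT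
    set A := (D \ U) \ (B ∪ (bdry E D ∪ BT)) with hA
    have hex : ∀ c, ∃ p : X × ℕ, c ∈ A → p ∈ I₀ ∧ c • x ∈ bowenBall (F p.2) p.1 r := by
      intro c
      by_cases hc : c ∈ A
      · have hcD : c ∈ D := (Finset.mem_sdiff.mp (Finset.mem_sdiff.mp hc).1).1
        have hcB : c ∉ B := fun h => (Finset.mem_sdiff.mp hc).2 (Finset.mem_union_left _ h)
        have hcV : c • x ∈ V₀ := by
          by_contra h
          exact hcB (hB c hcD fun h' => h h'.1)
        rw [hV₀, mem_iUnion₂] at hcV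
        obtain ⟨p, hp, h⟩ := hcV
        exact ⟨p, fun _ => ⟨hp, h⟩⟩
      · exact ⟨(x, 0), fun h => absurd h hc⟩
    choose lab hlab using hex
    obtain ⟨Q, hQA, hQd, hQc⟩ := cover_block F hFol.1 C hC0 hC (fun c => (lab c).2) ε hε hε1
      A.card A le_rfl
    set T₂ : Finset (G × X × ℕ) := Q.image fun c => (c, lab c) with hT₂
    have hinj : Function.Injective fun c : G => ((c, lab c) : G × X × ℕ) :=
      fun a b h => (Prod.mk.inj h).1
    have hcov₂ : T₂.biUnion (tile F) = Q.biUnion fun c => F (lab c).2 * {c} := by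
      rw [hT₂, Finset.image_biUnion]; rfl
    rw [← hcov₂] at hQd hQc
    set U₂ := T₂.biUnion (tile F) with hU₂
    -- tiles of the new family lie in `D \ U`
    have htile : ∀ c ∈ Q, tile F (c, lab c) ⊆ D \ U := by
      intro c hc u hu
      have hcA := hQA hc
      obtain ⟨g, hg, c', hc', rfl⟩ := Finset.mem_mul.mp hu
      rw [Finset.mem_singleton] at hc'
      subst hc'
      have hgE : g ∈ E := Finset.mem_biUnion.mpr ⟨_, (hlab _ hcA).1, hg⟩
      have hc1 := Finset.mem_sdiff.mp hcA
      have hc2 := Finset.mem_sdiff.mp hc1.1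
      have hc3 := hc1.2
      rw [Finset.mem_union, Finset.mem_union, not_or, not_or] at hc3
      refine Finset.mem_sdiff.mpr ⟨(not_mem_bdry hc3.2.1 hgE).mp hc2.1, fun hgU => hc2.2 ?_⟩
      obtain ⟨t, ht, htu⟩ := Finset.mem_biUnion.mp hgU
      obtain ⟨f, hf, a, ha, hfa⟩ := Finset.mem_mul.mp htu
      rw [Finset.mem_singleton] at ha
      subst ha
      have hnb : c' * t.1⁻¹ ∉ bdry E (F t.2.2) := by
        intro h
        exact hc3.2.2 (Finset.mem_biUnion.mpr ⟨t, ht, Finset.mem_mul.mpr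
          ⟨_, h, t.1, by simp, by group⟩⟩)
      have hin : c' * t.1⁻¹ ∈ F t.2.2 := by
        rw [not_mem_bdry hnb hgE, ← mul_assoc]
        have hfa' : f * t.1 = g * c' := hfa
        rw [← hfa', mul_inv_cancel_right]
        exact hf
      exact Finset.mem_biUnion.mpr ⟨t, ht, Finset.mem_mul.mpr ⟨_, hin, t.1, by simp, by group⟩⟩
    have hU₂sub : U₂ ⊆ D \ U := by
      rw [hU₂, hT₂, Finset.image_biUnion]
      exact Finset.biUnion_subset.mpr htile
    have hUdisj : Disjoint U U₂ :=
      Finset.disjoint_of_subset_right hU₂sub Finset.disjoint_sdiff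
    have hcov : (T ∪ T₂).biUnion (tile F) = U ∪ U₂ := Finset.union_biUnion
    have hDpos : (0 : ℝ) < D.card := by exact_mod_cast (hFol.1 m).card_pos
    refine ⟨T ∪ T₂, ?_, ?_, ?_⟩
    · intro t ht
      rcases Finset.mem_union.mp ht with h | h
      · obtain ⟨h1, h2, h3, h4⟩ := hT t h
        exact ⟨h1, Finset.mem_union_right _ h2, h3, h4⟩
      · obtain ⟨c, hc, rfl⟩ := Finset.mem_image.mp h
        have hcA := hQA hc
        refine ⟨(Finset.mem_sdiff.mp (Finset.mem_sdiff.mp hcA).1).1,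
          Finset.mem_union_left _ (hlab c hcA).1, (hlab c hcA).2,
          (htile c hc).trans Finset.sdiff_subset⟩
    · rw [hcov, Finset.card_union_of_disjoint hUdisj]
      have h1 : ∑ t ∈ T ∪ T₂, ((F t.2.2).card : ℝ) ≤
          ∑ t ∈ T, ((F t.2.2).card : ℝ) + ∑ t ∈ T₂, ((F t.2.2).card : ℝ) := by
        rw [← Finset.sum_union_inter]
        exact le_add_of_nonneg_right (Finset.sum_nonneg fun _ _ => by positivity)
      have h2 : ∑ t ∈ T₂, ((F t.2.2).card : ℝ) = ∑ c ∈ Q, ((F (lab c).2).card : ℝ) := by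
        rw [hT₂, Finset.sum_image (fun a _ b _ h => hinj h)]
      rw [h2] at h1
      have h3 := mul_le_mul_of_nonneg_left h1 (show (0 : ℝ) ≤ 1 - ε by linarith)
      push_cast
      linarith
    · rw [hcov]
      have hsd : ((D \ (U ∪ U₂)).card : ℝ) = (D \ U).card - U₂.card := by
        have h1 : D \ (U ∪ U₂) = (D \ U) \ U₂ := by
          ext; simp [not_or, and_assoc]
        rw [h1, Finset.card_sdiff_of_subset hU₂sub, Nat.cast_sub (Finset.card_le_card hU₂sub)]
      have hsumT : ∑ t ∈ T, ((F t.2.2).card : ℝ) ≤ 2 * D.card := by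
        have h1 : (U.card : ℝ) ≤ D.card := by exact_mod_cast Finset.card_le_card hUD
        have h0 : (0 : ℝ) ≤ ∑ t ∈ T, ((F t.2.2).card : ℝ) := Finset.sum_nonneg fun _ _ => by positivity
        nlinarith
      have hBTc : (BT.card : ℝ) ≤ 2 * θ * D.card := by
        calc (BT.card : ℝ) ≤ ∑ t ∈ T, ((bdry E (F t.2.2) * {t.1}).card : ℝ) := by
              exact_mod_cast Finset.card_biUnion_le
          _ ≤ ∑ t ∈ T, θ * ((F t.2.2).card : ℝ) := by
              refine Finset.sum_le_sum fun t ht => ?_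
              rw [Finset.card_mul_singleton]
              exact hN₁ _ ((le_max_right _ _).trans (hI₁N _ (hT t ht).2.1))
          _ = θ * ∑ t ∈ T, ((F t.2.2).card : ℝ) := by rw [Finset.mul_sum]
          _ ≤ _ := by nlinarith
      have hAc : ((D \ U).card : ℝ) - (ε' + 3 * θ) * D.card ≤ A.card := by
        have h1 : (D \ U).card ≤ A.card + (B.card + ((bdry E D).card + BT.card)) := by
          have h2 := Finset.le_card_sdiff (B ∪ (bdry E D ∪ BT)) (D \ U)
          rw [← hA] at h2
          have h3 := Finset.card_union_le B (bdry E D ∪ BT)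
          have h4 := Finset.card_union_le (bdry E D) BT
          omega
        have h5 : ((D \ U).card : ℝ) ≤ A.card + (B.card + ((bdry E D).card + BT.card)) := by
          exact_mod_cast h1
        linarith
      have hU₂c : γ * A.card ≤ U₂.card := by
        rw [hγ, inv_mul_eq_div, div_le_iff₀ (by linarith)]
        linarith
      rw [hsd, pow_succ]
      have h6 := mul_le_mul_of_nonneg_left hAc hγ0.le
      have h7 := mul_le_mul_of_nonneg_left hTc (show (0 : ℝ) ≤ 1 - γ by linarith)
      nlinarith

/-- Weighted counting of codes. -/
lemma count_codes {a b Λ : Type*} [DecidableEq Λ] (P : Finset a) (R : Finset b) (w : a → ℝ)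
    (hw : ∀ i, 0 ≤ w i) (κ : ℝ) (hκ : 0 ≤ κ) (W : ℝ) (hW : 0 < W)
    (dec : Finset a → Finset b → Λ) :
    ∃ S : Finset Λ, (S.card : ℝ) ≤ Real.exp (∑ i ∈ P, w i + R.card * κ) / W ∧
      ∀ T ⊆ P, ∀ E ⊆ R, W ≤ (∏ i ∈ T, w i) * κ ^ E.card → dec T E ∈ S := by
  classical
  set Z := (P.powerset ×ˢ R.powerset).filter
    (fun z => W ≤ (∏ i ∈ z.1, w i) * κ ^ z.2.card) with hZ
  refine ⟨Z.image fun z => dec z.1 z.2, ?_, ?_⟩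
  · rw [le_div_iff₀ hW]
    have h1 : ((Z.image fun z => dec z.1 z.2).card : ℝ) ≤ Z.card := by
      exact_mod_cast Finset.card_image_le
    have hnn : ∀ z : Finset a × Finset b, 0 ≤ (∏ i ∈ z.1, w i) * κ ^ z.2.card := fun z =>
      mul_nonneg (Finset.prod_nonneg fun i _ => hw i) (by positivity)
    calc ((Z.image fun z => dec z.1 z.2).card : ℝ) * W ≤ Z.card * W :=
          mul_le_mul_of_nonneg_right h1 hW.le
      _ = ∑ z ∈ Z, W := by simp
      _ ≤ ∑ z ∈ Z, (∏ i ∈ z.1, w i) * κ ^ z.2.card :=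
          Finset.sum_le_sum fun z hz => (Finset.mem_filter.mp hz).2
      _ ≤ ∑ z ∈ P.powerset ×ˢ R.powerset, (∏ i ∈ z.1, w i) * κ ^ z.2.card :=
          Finset.sum_le_sum_of_subset_of_nonneg (Finset.filter_subset _ _) fun z _ _ => hnn z
      _ = (∑ T ∈ P.powerset, ∏ i ∈ T, w i) * ∑ E ∈ R.powerset, ∏ _i ∈ E, κ := by
          rw [Finset.sum_product, Finset.sum_mul_sum]
          simp
      _ = (∏ i ∈ P, (1 + w i)) * ∏ _i ∈ R, (1 + κ) := by
          rw [Finset.prod_one_add, Finset.prod_one_add]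
      _ ≤ (∏ i ∈ P, Real.exp (w i)) * ∏ _i ∈ R, Real.exp κ := by
          refine mul_le_mul ?_ ?_ ?_ ?_
          · refine Finset.prod_le_prod (fun i _ => by linarith [hw i]) fun i _ => ?_
            linarith [Real.add_one_le_exp (w i)]
          · refine Finset.prod_le_prod (fun i _ => by linarith) fun i _ => ?_
            linarith [Real.add_one_le_exp κ]
          · exact Finset.prod_nonneg fun i _ => by linarith
          · exact Finset.prod_nonneg fun i _ => (Real.exp_pos _).le
      _ = _ := by
          rw [← Real.exp_sum, ← Real.exp_sum, ← Real.exp_add]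
          simp
  · intro T hT E hE h
    refine Finset.mem_image.mpr ⟨(T, E), Finset.mem_filter.mpr ⟨?_, h⟩, rfl⟩
    simp [hT, hE]

set_option maxHeartbeats 2000000 in
/-- The main estimate. -/
lemma entropy_eventually_le {G : Type*} [Group G] [DecidableEq G] {X : Type*} [MetricSpace X]
    [CompactSpace X] [MulAction G X] [ContinuousConstSMul G X] [MeasurableSpace X] [BorelSpace X]
    (F : ℕ → Finset G) (hFol : IsFolnerSeq F) (hTemp : IsTemperedSeq F) (hGrow : GrowthCond F)
    (μ : Measure X) [IsProbabilityMeasure μ] (hinv : InvariantMeasure G μ)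
    (Y : Set X) (hY : μ Y = 1) (s₀ s : ℝ) (hs0 : 0 < s) (hs : s₀ < s)
    (hfin : bowenMeasure F Y s₀ ≠ ⊤) {k : ℕ} (α : X → Fin k) (hα : Measurable α)
    (η : ℝ) (hη : 0 < η) :
    ∀ᶠ m in atTop, partitionEntropy μ α (F m) / (F m).card ≤ s + η := by
  classical
  have hX : Nonempty X := by
    by_contra h
    rw [not_nonempty_iff] at h
    have h1 := measure_univ (μ := μ)
    rw [univ_eq_empty_iff.mpr h, measure_empty] at h1
    exact zero_ne_one h1
  obtain ⟨x₀⟩ := hX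
  have hk : 0 < k := Fin.pos (α x₀)
  have hk1 : (1 : ℝ) ≤ k := by exact_mod_cast hk
  have hk0 : (0 : ℝ) < k := by linarith
  have hlogk : 0 ≤ Real.log k := Real.log_nonneg hk1
  obtain ⟨C', hC'⟩ := hTemp
  set C := max C' 0 with hCdef
  have hC0 : 0 ≤ C := le_max_right _ _
  have hC : ∀ n : ℕ, (((Finset.range n).biUnion fun k => (F k)⁻¹ * F n).card : ℝ)
      ≤ C * (F n).card := fun n =>
    (hC' n).trans (mul_le_mul_of_nonneg_right (le_max_left _ _) (by positivity))
  -- constants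
  obtain ⟨κ, hκ0, hκ1, hκk⟩ : ∃ κ : ℝ, 0 < κ ∧ κ ≤ 1 ∧ k * κ ≤ η / 6 := by
    refine ⟨min 1 (η / (6 * k)), by positivity, min_le_left _ _, ?_⟩
    calc (k : ℝ) * min 1 (η / (6 * k)) ≤ k * (η / (6 * k)) :=
          mul_le_mul_of_nonneg_left (min_le_right _ _) hk0.le
      _ = η / 6 := by field_simp
  set L := -Real.log κ with hL
  have hL0 : 0 ≤ L := by
    have := Real.log_nonpos hκ0.le hκ1
    linarith
  obtain ⟨ε, hε0, hε1, hεs⟩ : ∃ ε : ℝ, 0 < ε ∧ ε ≤ 1 / 2 ∧ 2 * ε * s ≤ η / 6 := by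
    refine ⟨min (1 / 2) (η / (12 * s)), by positivity, min_le_left _ _, ?_⟩
    calc 2 * min (1 / 2) (η / (12 * s)) * s ≤ 2 * (η / (12 * s)) * s := by
          gcongr; exact min_le_right _ _
      _ = η / 6 := by field_simp; norm_num
  obtain ⟨ρ, hρ0, hρL⟩ : ∃ ρ : ℝ, 0 < ρ ∧ ρ * L ≤ η / 6 := by
    refine ⟨η / (6 * (L + 1)), by positivity, ?_⟩
    rw [div_mul_eq_mul_div, div_le_div_iff₀ (by positivity) (by norm_num)]
    nlinarith
  set γ := (1 / ε + 2 * C)⁻¹ with hγ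
  have hγ0 : 0 < γ := by positivity
  obtain ⟨J, hJ⟩ := exists_pow_lt_of_lt_one (show (0 : ℝ) < ρ / 4 by positivity)
    (show 1 - γ < 1 by linarith)
  obtain ⟨δ, hδ0, hδ⟩ : ∃ δ : ℝ, 0 < δ ∧ (δ + δ) / (ρ / 8) * Real.log k ≤ η / 6 := by
    refine ⟨(ρ / 8) * η / (12 * (Real.log k + 1)), by positivity, ?_⟩
    have : ((ρ / 8) * η / (12 * (Real.log k + 1)) + (ρ / 8) * η / (12 * (Real.log k + 1))) / (ρ / 8)
        = η / (6 * (Real.log k + 1)) := by field_simp; norm_num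
    rw [this, div_mul_eq_mul_div, div_le_div_iff₀ (by positivity) (by norm_num)]
    nlinarith
  obtain ⟨K, r, lam, hK, hr, hKμ, hlam⟩ := exists_lusin μ α hα δ hδ0
  obtain ⟨I, V, -, hIτ, hV, hVμ, hev⟩ := multi_cover F hFol C hC0 hC μ s r
    (fun N₀ τ hτ δ hδ => exists_block F hGrow μ Y hY s₀ s hs hfin r hr N₀ τ hτ δ hδ)
    ε hε0 hε1 (ρ / 8) (ρ / 8) (by positivity) (by positivity) γ hγ J (η / 6) (by positivity) δ hδ0 0
  have hVK : MeasurableSet (V ∩ K) := hV.inter hK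
  have hVKμ : μ (V ∩ K)ᶜ ≤ ENNReal.ofReal (δ + δ) := by
    rw [compl_inter]
    refine (measure_union_le _ _).trans ((add_le_add hVμ hKμ).trans ?_)
    rw [← ENNReal.ofReal_add hδ0.le hδ0.le]
  have hcard := growth_card hGrow
  filter_upwards [hev, hcard.eventually_ge_atTop (Real.log 2 / (η / 6))] with m hm hmc
  set D := F m with hD
  have hDne : D.Nonempty := hFol.1 m
  have hDpos : (0 : ℝ) < D.card := by exact_mod_cast hDne.card_pos
  have hbad := bad_measure μ hinv D hDne (V ∩ K) hVK (δ + δ) (ρ / 8) (by positivity)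
    (by positivity) hVKμ
  set dec : Finset (G × X × ℕ) → Finset (G × Fin k) → (↥D → Fin k) := fun T E h =>
    if he : ∃ j, ((h : G), j) ∈ E then he.choose
    else if ht : ∃ t ∈ T, (h : G) ∈ tile F t then
      lam (((h : G) * ht.choose.1⁻¹) • ht.choose.2.1)
    else α x₀ with hdec
  set W := Real.exp (-(s + η / 6 + η / 6) * D.card) with hWdef
  obtain ⟨S, hScard, hS⟩ := count_codes (D ×ˢ I) (D ×ˢ (Finset.univ : Finset (Fin k)))
    (fun t => Real.exp (-s * ((F t.2.2).card : ℝ))) (fun _ => (Real.exp_pos _).le) κ hκ0.le W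
    (Real.exp_pos _) dec
  set Nm : X → (↥D → Fin k) := fun x g => α ((g : G) • x) with hNm
  have hNmm : Measurable Nm :=
    measurable_pi_lambda _ fun g => hα.comp (continuous_const_smul (g : G)).measurable
  -- good points have names in S
  have hgood : ∀ x, ((D.filter fun c => c • x ∉ V ∩ K).card : ℝ) ≤ ρ / 8 * D.card → Nm x ∈ S := by
    intro x hx
    set B := D.filter fun c => c • x ∉ V ∩ K with hB
    obtain ⟨T, hT, hTd, hTc⟩ := hm x B
      (fun c hc h => Finset.mem_filter.mpr ⟨hc, fun h' => h h'.1⟩) hx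
    set U := T.biUnion (tile F) with hU
    set E := ((D \ U) ∪ B).image fun h => (h, α (h • x)) with hE
    have hdecx : dec T E = Nm x := by
      funext h
      simp only [hdec, hNm]
      by_cases he : ∃ j, ((h : G), j) ∈ E
      · rw [dif_pos he]
        obtain ⟨h', _, hh⟩ := Finset.mem_image.mp he.choose_spec
        rw [Prod.mk.injEq] at hh
        rw [← hh.2, hh.1]
      · rw [dif_neg he]
        have hn : (h : G) ∉ (D \ U) ∪ B := fun hin =>
          he ⟨_, Finset.mem_image.mpr ⟨_, hin, rfl⟩⟩
        rw [Finset.mem_union, not_or] at hn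
        have hhU : (h : G) ∈ U := by
          by_contra hc
          exact hn.1 (Finset.mem_sdiff.mpr ⟨h.2, hc⟩)
        have hhK : (h : G) • x ∈ K := by
          by_contra hc
          exact hn.2 (Finset.mem_filter.mpr ⟨h.2, fun h' => hc h'.2⟩)
        have ht : ∃ t ∈ T, (h : G) ∈ tile F t := Finset.mem_biUnion.mp hhU
        rw [dif_pos ht]
        obtain ⟨htT, hth⟩ := ht.choose_spec
        set t := ht.choose
        obtain ⟨g, hg, c, hc, hgc⟩ := Finset.mem_mul.mp hth
        rw [Finset.mem_singleton] at hc
        subst hc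
        have hball := (hT t htT).2.2.1 g hg
        have hgc' : g * t.1 = (h : G) := hgc
        rw [← hgc', mul_inv_cancel_right]
        refine hlam _ (by rw [hgc']; exact hhK) _ ?_
        rw [mul_smul]
        exact hball
    rw [← hdecx]
    refine hS T ?_ E ?_ ?_
    · intro t ht
      exact Finset.mem_product.mpr ⟨(hT t ht).1, (hT t ht).2.1⟩
    · intro e he
      obtain ⟨h, hh, rfl⟩ := Finset.mem_image.mp he
      refine Finset.mem_product.mpr ⟨?_, Finset.mem_univ _⟩
      rcases Finset.mem_union.mp hh with h1 | h1
      · exact (Finset.mem_sdiff.mp h1).1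
      · exact (Finset.mem_filter.mp h1).1
    · have hEc : (E.card : ℝ) ≤ ρ * D.card := by
        have h1 : E.card ≤ (D \ U).card + B.card :=
          Finset.card_image_le.trans (Finset.card_union_le _ _)
        have h2 : (E.card : ℝ) ≤ (D \ U).card + B.card := by exact_mod_cast h1
        have h3 : ((1 - γ) ^ J + ρ / 8 + 3 * (ρ / 8)) * (D.card : ℝ) ≤
            (ρ / 4 + ρ / 8 + 3 * (ρ / 8)) * D.card :=
          mul_le_mul_of_nonneg_right (by linarith) hDpos.le
        nlinarith
      have hκE : κ ^ E.card = Real.exp (-L * E.card) := by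
        rw [hL, neg_neg, mul_comm, Real.exp_nat_mul, Real.exp_log hκ0]
      have hUD : (U.card : ℝ) ≤ D.card := by
        exact_mod_cast Finset.card_le_card (Finset.biUnion_subset.mpr fun t ht => (hT t ht).2.2.2)
      have hsum : s * ∑ t ∈ T, ((F t.2.2).card : ℝ) ≤ (s + η / 6) * D.card := by
        set tot := ∑ t ∈ T, ((F t.2.2).card : ℝ)
        have h1 : (1 - ε) * tot ≤ D.card := hTd.trans hUD
        have h2 : tot ≤ (1 + 2 * ε) * D.card := by
          have h3 : (1 + 2 * ε) * ((1 - ε) * tot) ≤ (1 + 2 * ε) * D.card :=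
            mul_le_mul_of_nonneg_left h1 (by linarith)
          have h4 : 0 ≤ tot := Finset.sum_nonneg fun _ _ => by positivity
          have h5 : 0 ≤ ε * (1 - 2 * ε) * tot :=
            mul_nonneg (mul_nonneg hε0.le (by linarith)) h4
          nlinarith
        have h6 := mul_le_mul_of_nonneg_left h2 hs0.le
        have h7 := mul_le_mul_of_nonneg_right hεs hDpos.le
        nlinarith
      rw [hκE, ← Real.exp_sum, ← Real.exp_add, hWdef]
      refine Real.exp_le_exp.mpr ?_
      rw [← Finset.mul_sum]
      have h8 : L * E.card ≤ η / 6 * D.card := by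
        have h9 := mul_le_mul_of_nonneg_left hEc hL0
        have h10 := mul_le_mul_of_nonneg_right hρL hDpos.le
        nlinarith
      linarith
  -- the entropy estimate
  set p : (↥D → Fin k) → ℝ := fun f => (μ {x | ∀ g : ↥D, α ((g : G) • x) = f g}).toReal with hp
  have hpre : ∀ f, {x | ∀ g : ↥D, α ((g : G) • x) = f g} = Nm ⁻¹' {f} := by
    intro f; ext x
    exact funext_iff.symm
  have hpS : ∀ R : Finset (↥D → Fin k), ∑ f ∈ R, p f = μ.real (Nm ⁻¹' R) := by
    intro R
    rw [Measure.real, ← sum_measure_preimage_singleton R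
      (fun f _ => hNmm (measurableSet_singleton f)), ENNReal.toReal_sum (fun _ _ => measure_ne_top _ _)]
    exact Finset.sum_congr rfl fun f _ => by rw [hp]; simp only [hpre]
  have hH := entropy_bound p (fun f => ENNReal.toReal_nonneg)
    (by rw [hpS]; simp) S (Real.exp ((s + 4 * (η / 6)) * D.card)) ((k : ℝ) ^ D.card)
    ((δ + δ) / (ρ / 8)) (Real.one_le_exp (by positivity)) (one_le_pow₀ hk1)
    (by
      refine hScard.trans ?_
      rw [hWdef, ← Real.exp_sub]
      refine Real.exp_le_exp.mpr ?_
      have h1 : ∑ t ∈ D ×ˢ I, Real.exp (-s * ((F t.2.2).card : ℝ)) ≤ D.card * (η / 6) := by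
        rw [Finset.sum_product]
        simp only [Finset.sum_const, nsmul_eq_mul]
        exact mul_le_mul_of_nonneg_left hIτ hDpos.le
      rw [Finset.card_product, Finset.card_univ, Fintype.card_fin]
      push_cast
      have h2 := mul_le_mul_of_nonneg_left hκk hDpos.le
      nlinarith)
    (by simp)
    (by
      rw [hpS]
      refine le_trans (measureReal_mono ?_) hbad
      intro x hx
      by_contra h
      simp only [mem_ofPred_eq, not_lt] at h
      have := hgood x h
      simp [this] at hx)
  rw [Real.log_exp, Real.log_pow] at hH
  rw [div_le_iff₀ hDpos]
  rw [div_le_iff₀ (by positivity)] at hmc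
  have h3 := mul_le_mul_of_nonneg_left hδ hDpos.le
  have h4 : partitionEntropy μ α D = ∑ f, Real.negMulLog (p f) := rfl
  rw [h4]
  nlinarith

end Helpers

variable {G : Type*} [Group G] [Countable G] [Infinite G] [DecidableEq G]
  {X : Type*} [MetricSpace X] [CompactSpace X] [MulAction G X] [ContinuousConstSMul G X]
  [MeasurableSpace X] [BorelSpace X]

theorem measEntropy_le_bowenEntropy_of_full_measure
    (F : ℕ → Finset G) (hFol : IsFolnerSeq F) (hTemp : IsTemperedSeq F) (hGrow : GrowthCond F)
    (μ : Measure X) [IsProbabilityMeasure μ] (hinv : InvariantMeasure G μ)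
    (Y : Set X) (hY : μ Y = 1) :
    measEntropy F μ ≤ bowenEntropy F Y := by
  by_cases htop : bowenEntropy F Y = ⊤
  · rw [htop]; exact le_top
  set b := (bowenEntropy F Y).toReal with hb
  have hb0 : 0 ≤ b := ENNReal.toReal_nonneg
  have hbe : bowenEntropy F Y = ENNReal.ofReal b := (ENNReal.ofReal_toReal htop).symm
  refine iSup_le fun k => iSup_le fun α => iSup_le fun hα => ?_
  rw [hbe]
  refine ENNReal.le_of_forall_pos_le_add fun e he _ => ?_
  have he' : (0 : ℝ) < e := he
  have hfin : bowenMeasure F Y (b + e / 3) ≠ ⊤ := by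
    intro h
    have h1 : ENNReal.ofReal (b + e / 3) ≤ bowenEntropy F Y :=
      le_iSup₂ (f := fun (s : ℝ) (_ : bowenMeasure F Y s = ⊤) => ENNReal.ofReal s) _ h
    rw [hbe, ENNReal.ofReal_le_ofReal_iff hb0] at h1
    linarith
  have hev := entropy_eventually_le F hFol hTemp hGrow μ hinv Y hY (b + e / 3) (b + e / 3 + e / 3)
    (by positivity) (by linarith) hfin α hα (e / 3) (by positivity)
  refine limsup_le_of_le (by isBoundedDefault) ?_
  filter_upwards [hev] with m hm
  refine (ENNReal.ofReal_le_ofReal hm).trans ?_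
  rw [← ENNReal.ofReal_coe_nnreal, ← ENNReal.ofReal_add hb0 he'.le]
  exact ENNReal.ofReal_le_ofReal (by linarith)
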